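/- A dcpo P is an algebraic domain if and only if P is a quasialgebraic domain and P is meet-continuous. -/

import Mathlib

open Set

/-- The upper set `↑A` generated by a subset `A` of a preordered set. -/
def upSet {P : Type*} [Preorder P] (A : Set P) : Set P := {y | ∃ a ∈ A, a ≤ y}

/-- The lower set `↓A` generated by a subset `A` of a preordered set. -/
def downSet {P : Type*} [Preorder P] (A : Set P) : Set P := {y | ∃ a ∈ A, y ≤ a}

/-- A poset is a dcpo if every (nonempty) directed subset has a least upper bound. -/
def IsDcpo (P : Type*) [Preorder P] : Prop :=
  ∀ D : Set P, D.Nonempty → DirectedOn (· ≤ ·) D → ∃ s, IsLUB D s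

/-- A subset `U` is Scott open if it is an upper set and every directed set whose
supremum lies in `U` meets `U`. -/
def ScottOpen {P : Type*} [Preorder P] (U : Set P) : Prop :=
  IsUpperSet U ∧ ∀ D : Set P, ∀ s : P, D.Nonempty → DirectedOn (· ≤ ·) D →
    IsLUB D s → s ∈ U → (D ∩ U).Nonempty

/-- The Scott topology `σ(P)`. -/
def scottT (P : Type*) [Preorder P] : TopologicalSpace P where
  IsOpen := ScottOpen
  isOpen_univ := ⟨isUpperSet_univ, fun D _ hD _ _ _ => hD.imp fun _ hd => ⟨hd, trivial⟩⟩
  isOpen_inter := by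
    rintro U V ⟨hU, hU'⟩ ⟨hV, hV'⟩
    refine ⟨hU.inter hV, fun D s hD hdir hlub hs => ?_⟩
    obtain ⟨d₁, hd₁D, hd₁U⟩ := hU' D s hD hdir hlub hs.1
    obtain ⟨d₂, hd₂D, hd₂V⟩ := hV' D s hD hdir hlub hs.2
    obtain ⟨d, hdD, h₁, h₂⟩ := hdir d₁ hd₁D d₂ hd₂D
    exact ⟨d, hdD, hU h₁ hd₁U, hV h₂ hd₂V⟩
  isOpen_sUnion := by
    intro S hS
    refine ⟨isUpperSet_sUnion fun U hU => (hS U hU).1, fun D s hD hdir hlub hs => ?_⟩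
    obtain ⟨U, hUS, hsU⟩ := hs
    obtain ⟨d, hdD, hdU⟩ := (hS U hUS).2 D s hD hdir hlub hsU
    exact ⟨d, hdD, U, hUS, hdU⟩

/-- Scott interior. -/
def scottInt (P : Type*) [Preorder P] (A : Set P) : Set P := @interior P (scottT P) A

/-- Scott closure. -/
def scottCl (P : Type*) [Preorder P] (A : Set P) : Set P := @closure P (scottT P) A

/-- The lower topology `ω(P)`, generated by the complements of principal upper sets. -/
def lowerT (P : Type*) [Preorder P] : TopologicalSpace P :=
  .generateFrom {V | ∃ x : P, V = (Ici x)ᶜ}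

/-- The upper topology `υ(P)`, generated by the complements of principal lower sets. -/
def upperT (P : Type*) [Preorder P] : TopologicalSpace P :=
  .generateFrom {V | ∃ x : P, V = (Iic x)ᶜ}

/-- The Lawson topology `λ(P)`, generated by `σ(P) ∪ ω(P)`. -/
def lawsonT (P : Type*) [Preorder P] : TopologicalSpace P :=
  .generateFrom ({U | ScottOpen U} ∪ {V | ∃ x : P, V = (Ici x)ᶜ})

/-- The interval topology `θ(P)`, generated by `ω(P) ∪ υ(P)`. -/
def intervalT (P : Type*) [Preorder P] : TopologicalSpace P :=
  .generateFrom ({V | ∃ x : P, V = (Ici x)ᶜ} ∪ {V | ∃ x : P, V = (Iic x)ᶜ})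

/-- `A ≪ B`: for every directed set `D` with `sup D ∈ ↑B`, `D` meets `↑A`. -/
def WayBelowSet {P : Type*} [Preorder P] (A B : Set P) : Prop :=
  ∀ D : Set P, ∀ s : P, D.Nonempty → DirectedOn (· ≤ ·) D → IsLUB D s →
    s ∈ upSet B → (D ∩ upSet A).Nonempty

/-- `u ≪ x`: every directed set `D` with `sup D ≥ x` contains some `d ≥ u`. -/
def WayBelowPt {P : Type*} [Preorder P] (u x : P) : Prop :=
  ∀ D : Set P, ∀ s : P, D.Nonempty → DirectedOn (· ≤ ·) D → IsLUB D s →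
    x ≤ s → ∃ d ∈ D, u ≤ d

/-- A family of sets is filtered if it is (nonempty and) directed under reverse inclusion. -/
def Filtered {P : Type*} (𝒜 : Set (Set P)) : Prop :=
  𝒜.Nonempty ∧ ∀ S ∈ 𝒜, ∀ T ∈ 𝒜, ∃ R ∈ 𝒜, R ⊆ S ∧ R ⊆ T

/-- The family `{↑F : F nonempty finite, F ≪ x}`. -/
def finWayFamily {P : Type*} [Preorder P] (x : P) : Set (Set P) :=
  {S | ∃ F : Set P, F.Nonempty ∧ F.Finite ∧ WayBelowSet F {x} ∧ S = upSet F}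

/-- A quasicontinuous domain. -/
def IsQuasicontinuousDomain (P : Type*) [Preorder P] : Prop :=
  ∀ x : P, Filtered (finWayFamily x) ∧ Ici x = ⋂₀ finWayFamily x

/-- The family `{↑F : F nonempty finite, x ∈ ↑F, F ≪ F}`. -/
def finCompactFamily {P : Type*} [Preorder P] (x : P) : Set (Set P) :=
  {S | ∃ F : Set P, F.Nonempty ∧ F.Finite ∧ x ∈ upSet F ∧ WayBelowSet F F ∧ S = upSet F}

/-- A quasialgebraic domain. -/
def IsQuasialgebraicDomain (P : Type*) [Preorder P] : Prop :=
  ∀ x : P, Filtered (finCompactFamily x) ∧ Ici x = ⋂₀ finCompactFamily x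

/-- A continuous domain: every `⇓x` is directed (hence nonempty) with supremum `x`. -/
def IsContinuousDomain (P : Type*) [Preorder P] : Prop :=
  ∀ x : P, {u | WayBelowPt u x}.Nonempty ∧ DirectedOn (· ≤ ·) {u | WayBelowPt u x} ∧
    IsLUB {u | WayBelowPt u x} x

/-- The set `K(P)` of compact elements. -/
def compacts (P : Type*) [Preorder P] : Set P := {k | WayBelowPt k k}

/-- An algebraic domain. -/
def IsAlgebraicDomain (P : Type*) [Preorder P] : Prop :=
  ∀ x : P, (compacts P ∩ Iic x).Nonempty ∧ DirectedOn (· ≤ ·) (compacts P ∩ Iic x) ∧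
    IsLUB (compacts P ∩ Iic x) x

/-- A meet-continuous dcpo: whenever `x ≤ sup D` for a directed set `D`,
`x` lies in the Scott closure of `↓x ∩ ↓D`. -/
def MeetContinuous (P : Type*) [Preorder P] : Prop :=
  ∀ x : P, ∀ D : Set P, ∀ s : P, D.Nonempty → DirectedOn (· ≤ ·) D → IsLUB D s → x ≤ s →
    x ∈ scottCl P (Iic x ∩ downSet D)

/-- The set of dyadic rationals in `[0,1]`. -/
def dyadics : Set ℝ := {t | ∃ m n : ℕ, m ≤ 2 ^ n ∧ t = (m : ℝ) / 2 ^ n}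

section DomainLemmas

variable {P : Type*} [Preorder P]

theorem isUpperSet_upSet (A : Set P) : IsUpperSet (upSet A) :=
  fun _ _ hxy ⟨a, ha, hax⟩ => ⟨a, ha, hax.trans hxy⟩

theorem mem_upSet_singleton {a y : P} : y ∈ upSet {a} ↔ a ≤ y := by
  simp [upSet]

theorem WayBelowSet.scottOpen_upSet {F : Set P} (hF : WayBelowSet F F) : ScottOpen (upSet F) :=
  ⟨isUpperSet_upSet F, hF⟩

theorem wayBelowSet_singleton_of_mem_compacts {k : P} (hk : k ∈ compacts P) :
    WayBelowSet {k} {k} := by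
  intro D s hD hdir hlub hs
  obtain ⟨d, hd, hkd⟩ := hk D s hD hdir hlub (mem_upSet_singleton.1 hs)
  exact ⟨d, hd, mem_upSet_singleton.2 hkd⟩

theorem upSet_singleton_mem_finCompactFamily {k x : P} (hk : k ∈ compacts P) (hkx : k ≤ x) :
    upSet {k} ∈ finCompactFamily x :=
  ⟨{k}, singleton_nonempty k, finite_singleton k, mem_upSet_singleton.2 hkx,
    wayBelowSet_singleton_of_mem_compacts hk, rfl⟩

theorem mem_scottCl_iff {A : Set P} {x : P} :
    x ∈ scottCl P A ↔ ∀ U, ScottOpen U → x ∈ U → (U ∩ A).Nonempty :=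
  @mem_closure_iff P (scottT P) x A

theorem IsAlgebraicDomain.isQuasialgebraicDomain (h : IsAlgebraicDomain P) :
    IsQuasialgebraicDomain P := by
  intro x
  obtain ⟨hne, hdir, hlub⟩ := h x
  refine ⟨⟨?_, ?_⟩, Subset.antisymm ?_ fun y hy => ?_⟩
  · obtain ⟨k, hk, hkx⟩ := hne
    exact ⟨_, upSet_singleton_mem_finCompactFamily hk hkx⟩
  · rintro _ ⟨F, -, -, hxF, hF, rfl⟩ _ ⟨G, -, -, hxG, hG, rfl⟩
    obtain ⟨k, hkx, hkF⟩ := hF _ x hne hdir hlub hxF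
    obtain ⟨l, hlx, hlG⟩ := hG _ x hne hdir hlub hxG
    obtain ⟨m, hmx, hkm, hlm⟩ := hdir k hkx l hlx
    refine ⟨_, upSet_singleton_mem_finCompactFamily hmx.1 hmx.2, fun y hy => ?_, fun y hy => ?_⟩
    · exact isUpperSet_upSet F (hkm.trans (mem_upSet_singleton.1 hy)) hkF
    · exact isUpperSet_upSet G (hlm.trans (mem_upSet_singleton.1 hy)) hlG
  · rintro y hxy _ ⟨F, -, -, hxF, -, rfl⟩
    exact isUpperSet_upSet F hxy hxF
  · exact hlub.2 fun k hk =>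
      mem_upSet_singleton.1 (hy _ (upSet_singleton_mem_finCompactFamily hk.1 hk.2))

theorem IsAlgebraicDomain.meetContinuous (h : IsAlgebraicDomain P) : MeetContinuous P := by
  intro x D s hD hdir hlub hxs
  refine mem_scottCl_iff.2 fun U hU hxU => ?_
  obtain ⟨hne, hdirx, hlubx⟩ := h x
  obtain ⟨k, ⟨hk, hkx⟩, hkU⟩ := hU.2 _ x hne hdirx hlubx hxU
  obtain ⟨d, hd, hkd⟩ := hk D s hD hdir hlub (le_trans hkx hxs)
  exact ⟨k, hkU, hkx, d, hd, hkd⟩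

/-- In a meet-continuous poset, minimal elements of a set generating a Scott open upper set
are compact. -/
theorem MeetContinuous.mem_compacts_of_minimal (hP : MeetContinuous P) {F : Set P}
    (hF : WayBelowSet F F) {a : P} (ha : Minimal (· ∈ F) a) : a ∈ compacts P := by
  intro D s hD hdir hlub has
  obtain ⟨b, ⟨f, hf, hfb⟩, hba, d, hd, hbd⟩ :=
    mem_scottCl_iff.1 (hP a D s hD hdir hlub has) _ hF.scottOpen_upSet ⟨a, ha.prop, le_rfl⟩
  exact ⟨d, hd, (ha.le_of_le hf (hfb.trans hba)).trans (hfb.trans hbd)⟩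

theorem MeetContinuous.exists_mem_compacts_le (hP : MeetContinuous P) {F : Set P}
    (hfin : F.Finite) (hF : WayBelowSet F F) {x : P} (hx : x ∈ upSet F) :
    ∃ k ∈ compacts P ∩ Iic x, k ∈ F := by
  obtain ⟨f, hf, hfx⟩ := hx
  obtain ⟨a, haf, ha⟩ := hfin.exists_le_minimal hf
  exact ⟨a, ⟨hP.mem_compacts_of_minimal hF ha, haf.trans hfx⟩, ha.prop⟩

theorem IsQuasialgebraicDomain.isAlgebraicDomain (hq : IsQuasialgebraicDomain P)
    (hP : MeetContinuous P) : IsAlgebraicDomain P := by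
  intro x
  obtain ⟨⟨hne, hfilt⟩, hInter⟩ := hq x
  refine ⟨?_, ?_, fun k hk => hk.2, fun y hy => ?_⟩
  · obtain ⟨_, F, -, hfin, hxF, hF, rfl⟩ := hne
    obtain ⟨k, hk, -⟩ := hP.exists_mem_compacts_le hfin hF hxF
    exact ⟨k, hk⟩
  · rintro k ⟨hk, hkx⟩ l ⟨hl, hlx⟩
    obtain ⟨_, ⟨F, -, hfin, hxF, hF, rfl⟩, hFk, hFl⟩ :=
      hfilt _ (upSet_singleton_mem_finCompactFamily hk hkx)
        _ (upSet_singleton_mem_finCompactFamily hl hlx)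
    obtain ⟨m, hm, hmF⟩ := hP.exists_mem_compacts_le hfin hF hxF
    exact ⟨m, hm, mem_upSet_singleton.1 (hFk ⟨m, hmF, le_rfl⟩),
      mem_upSet_singleton.1 (hFl ⟨m, hmF, le_rfl⟩)⟩
  · change y ∈ Ici x
    rw [hInter]
    rintro _ ⟨F, -, hfin, hxF, hF, rfl⟩
    obtain ⟨k, hk, hkF⟩ := hP.exists_mem_compacts_le hfin hF hxF
    exact ⟨k, hkF, hy hk⟩

end DomainLemmas

/-- A dcpo is an algebraic domain iff it is a quasialgebraic domain
and meet-continuous. -/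
theorem algebraic_iff_quasialgebraic_and_meetContinuous
    (P : Type*) [PartialOrder P] (hdcpo : IsDcpo P) :
    IsAlgebraicDomain P ↔ IsQuasialgebraicDomain P ∧ MeetContinuous P := by
  exact ⟨fun h => ⟨h.isQuasialgebraicDomain, h.meetContinuous⟩, fun h => h.1.isAlgebraicDomain h.2⟩
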